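/- Let m > n and K ≥ 0, suppose (ℝ^n, φ) satisfies the CD(−K, m) condition, let u : (0,∞) × ℝ^n → ℝ be a smooth positive solution of ∂ₜu = Lu, and set h(t,x) = ∂ₜu − e^{−2Kt}|∇u|²/u + e^{2Kt}(m/(2t)) u. Then for all t > 0 the pointwise inequality (∂ₜ − L)h ≥ (2/(m u)) e^{−2Kt} (∂ₜu − |∇u|²/u)² − e^{2Kt}(m/(2t²)) u holds on (0,∞) × ℝ^n. (Euclidean case of the evolution inequality (3.1) for h in the proof of the paper's Theorem 2.1.) -/

import Mathlib

open scoped RealInnerProductSpace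

noncomputable section

/-- Hessian of `f` at `x`, evaluated at the pair of vectors `(v, w)`. -/
def hess (n : ℕ) (f : EuclideanSpace ℝ (Fin n) → ℝ) (x v w : EuclideanSpace ℝ (Fin n)) : ℝ :=
  fderiv ℝ (fun y => fderiv ℝ f y v) x w

/-- Laplacian `Δf = tr ∇²f`. -/
def lap (n : ℕ) (f : EuclideanSpace ℝ (Fin n) → ℝ) (x : EuclideanSpace ℝ (Fin n)) : ℝ :=
  ∑ i : Fin n, hess n f x (EuclideanSpace.single i 1) (EuclideanSpace.single i 1)

/-- Witten Laplacian `Lf = Δf − ⟨∇φ, ∇f⟩`. -/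
def witten (n : ℕ) (φ f : EuclideanSpace ℝ (Fin n) → ℝ) (x : EuclideanSpace ℝ (Fin n)) : ℝ :=
  lap n f x - ⟪gradient φ x, gradient f x⟫

/-- Squared Frobenius norm of the Hessian. -/
def hessNormSq (n : ℕ) (f : EuclideanSpace ℝ (Fin n) → ℝ) (x : EuclideanSpace ℝ (Fin n)) : ℝ :=
  ∑ i : Fin n, ∑ j : Fin n,
    (hess n f x (EuclideanSpace.single i 1) (EuclideanSpace.single j 1)) ^ 2

/-- The `CD(−K, m)` condition on Euclidean space `ℝⁿ`:
`∇²φ(v,v) − ⟨∇φ, v⟩²/(m−n) ≥ −K|v|²` at every point and for every vector. -/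
def CDcond (n : ℕ) (φ : EuclideanSpace ℝ (Fin n) → ℝ) (m K : ℝ) : Prop :=
  ∀ x v : EuclideanSpace ℝ (Fin n),
    hess n φ x v v - ⟪gradient φ x, v⟫ ^ 2 / (m - n) ≥ -K * ‖v‖ ^ 2

open scoped ContDiff

section DirectionalDerivative

variable {X : Type*} [NormedAddCommGroup X] [NormedSpace ℝ X]

/-- The directional derivative of `F` along the constant vector field `v`. -/
def dirDeriv (v : X) (F : X → ℝ) (p : X) : ℝ := fderiv ℝ F p v

variable {Ω : Set X} {F G : X → ℝ} {p : X}

lemma ContDiffOn.differentiableAt_of_isOpen (hΩ : IsOpen Ω) (hF : ContDiffOn ℝ ∞ F Ω)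
    (hp : p ∈ Ω) : DifferentiableAt ℝ F p :=
  (hF.contDiffAt (hΩ.mem_nhds hp)).differentiableAt (by simp)

lemma ContDiffOn.dirDeriv (hΩ : IsOpen Ω) (hF : ContDiffOn ℝ ∞ F Ω) (v : X) :
    ContDiffOn ℝ ∞ (dirDeriv v F) Ω :=
  (hF.fderiv_of_isOpen hΩ (by simp)).clm_apply contDiffOn_const

lemma dirDeriv_congr (hΩ : IsOpen Ω) (hFG : Set.EqOn F G Ω) (v : X) :
    Set.EqOn (dirDeriv v F) (dirDeriv v G) Ω := by
  intro p hp
  have h : F =ᶠ[nhds p] G := hFG.eventuallyEq_of_mem (hΩ.mem_nhds hp)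
  simp only [dirDeriv, h.fderiv_eq]

lemma dirDeriv_add (hF : DifferentiableAt ℝ F p) (hG : DifferentiableAt ℝ G p) (v : X) :
    dirDeriv v (fun q => F q + G q) p = dirDeriv v F p + dirDeriv v G p := by
  simp [dirDeriv, fderiv_fun_add hF hG]

lemma dirDeriv_sub (hF : DifferentiableAt ℝ F p) (hG : DifferentiableAt ℝ G p) (v : X) :
    dirDeriv v (fun q => F q - G q) p = dirDeriv v F p - dirDeriv v G p := by
  simp [dirDeriv, fderiv_fun_sub hF hG]

lemma dirDeriv_mul (hF : DifferentiableAt ℝ F p) (hG : DifferentiableAt ℝ G p) (v : X) :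
    dirDeriv v (fun q => F q * G q) p = dirDeriv v F p * G p + F p * dirDeriv v G p := by
  simp [dirDeriv, fderiv_fun_mul hF hG]
  ring

lemma dirDeriv_sum {ι : Type*} [Fintype ι] {A : ι → X → ℝ}
    (hA : ∀ i, DifferentiableAt ℝ (A i) p) (v : X) :
    dirDeriv v (fun q => ∑ i, A i q) p = ∑ i, dirDeriv v (A i) p := by
  simp [dirDeriv, fderiv_fun_sum (fun i _ => hA i)]

lemma dirDeriv_dirDeriv_eq_fderiv (hΩ : IsOpen Ω) (hF : ContDiffOn ℝ ∞ F Ω) (hp : p ∈ Ω)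
    (v w : X) : dirDeriv v (dirDeriv w F) p = fderiv ℝ (fderiv ℝ F) p v w := by
  have hd : DifferentiableAt ℝ (fderiv ℝ F) p :=
    ((hF.fderiv_of_isOpen hΩ (m := ∞) (by simp)).contDiffAt (hΩ.mem_nhds hp)).differentiableAt
      (by simp)
  change fderiv ℝ (fun q => fderiv ℝ F q w) p v = _
  rw [fderiv_clm_apply hd (by fun_prop)]
  simp

lemma dirDeriv_comm (hΩ : IsOpen Ω) (hF : ContDiffOn ℝ ∞ F Ω) (hp : p ∈ Ω) (v w : X) :
    dirDeriv v (dirDeriv w F) p = dirDeriv w (dirDeriv v F) p := by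
  rw [dirDeriv_dirDeriv_eq_fderiv hΩ hF hp, dirDeriv_dirDeriv_eq_fderiv hΩ hF hp]
  exact ((hF.contDiffAt (hΩ.mem_nhds hp)).isSymmSndFDerivAt
    (by simpa using WithTop.coe_le_coe.2 (le_top : (2 : ℕ∞) ≤ ⊤))) v w

end DirectionalDerivative

section HeatOperator

variable {X : Type*} [NormedAddCommGroup X] [NormedSpace ℝ X] {ι : Type*} [Fintype ι]

/-- The operator `∂_τ F − ∑ i, ∂ᵢ∂ᵢ F + ∑ i, ∂ᵢΦ ∂ᵢF`. -/
def heatOp (τ : X) (e : ι → X) (Φ F : X → ℝ) (p : X) : ℝ :=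
  dirDeriv τ F p - (∑ i, dirDeriv (e i) (dirDeriv (e i) F) p
    - ∑ i, dirDeriv (e i) Φ p * dirDeriv (e i) F p)

variable {Ω : Set X} {Φ F G : X → ℝ} {p : X} {τ : X} {e : ι → X}

lemma heatOp_congr (hΩ : IsOpen Ω) (hFG : Set.EqOn F G Ω) :
    Set.EqOn (heatOp τ e Φ F) (heatOp τ e Φ G) Ω := by
  intro p hp
  have h1 (i : ι) := dirDeriv_congr hΩ hFG (e i)
  have h2 (i : ι) := dirDeriv_congr hΩ (h1 i) (e i) hp
  simp only [heatOp, dirDeriv_congr hΩ hFG τ hp, fun i => h1 i hp, h2]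

lemma heatOp_add (hΩ : IsOpen Ω) (hF : ContDiffOn ℝ ∞ F Ω) (hG : ContDiffOn ℝ ∞ G Ω)
    (hp : p ∈ Ω) :
    heatOp τ e Φ (fun q => F q + G q) p = heatOp τ e Φ F p + heatOp τ e Φ G p := by
  have h1 (v : X) : Set.EqOn (dirDeriv v fun q => F q + G q)
      (fun q => dirDeriv v F q + dirDeriv v G q) Ω := fun q hq =>
    dirDeriv_add (hF.differentiableAt_of_isOpen hΩ hq) (hG.differentiableAt_of_isOpen hΩ hq) v
  have h2 (i : ι) := (dirDeriv_congr hΩ (h1 (e i)) (e i) hp).trans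
    (dirDeriv_add ((hF.dirDeriv hΩ _).differentiableAt_of_isOpen hΩ hp)
      ((hG.dirDeriv hΩ _).differentiableAt_of_isOpen hΩ hp) (e i))
  simp only [heatOp, h1 _ hp, h2, mul_add, Finset.sum_add_distrib]
  ring

lemma heatOp_mul (hΩ : IsOpen Ω) (hF : ContDiffOn ℝ ∞ F Ω) (hG : ContDiffOn ℝ ∞ G Ω)
    (hp : p ∈ Ω) :
    heatOp τ e Φ (fun q => F q * G q) p = heatOp τ e Φ F p * G p + F p * heatOp τ e Φ G p
      - 2 * ∑ i, dirDeriv (e i) F p * dirDeriv (e i) G p := by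
  have h1 (v : X) : Set.EqOn (dirDeriv v fun q => F q * G q)
      (fun q => dirDeriv v F q * G q + F q * dirDeriv v G q) Ω := fun q hq =>
    dirDeriv_mul (hF.differentiableAt_of_isOpen hΩ hq) (hG.differentiableAt_of_isOpen hΩ hq) v
  have h2 (i : ι) : dirDeriv (e i) (dirDeriv (e i) fun q => F q * G q) p =
      dirDeriv (e i) (dirDeriv (e i) F) p * G p + F p * dirDeriv (e i) (dirDeriv (e i) G) p
        + 2 * (dirDeriv (e i) F p * dirDeriv (e i) G p) := by
    have dF := hF.differentiableAt_of_isOpen hΩ hp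
    have dG := hG.differentiableAt_of_isOpen hΩ hp
    have dF' := (hF.dirDeriv hΩ (e i)).differentiableAt_of_isOpen hΩ hp
    have dG' := (hG.dirDeriv hΩ (e i)).differentiableAt_of_isOpen hΩ hp
    rw [dirDeriv_congr hΩ (h1 (e i)) (e i) hp, dirDeriv_add (dF'.fun_mul dG) (dF.fun_mul dG'),
      dirDeriv_mul dF' dG, dirDeriv_mul dF dG']
    ring
  have h3 (i : ι) : dirDeriv (e i) Φ p * (dirDeriv (e i) F p * G p + F p * dirDeriv (e i) G p)
      = dirDeriv (e i) Φ p * dirDeriv (e i) F p * G p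
        + F p * (dirDeriv (e i) Φ p * dirDeriv (e i) G p) := by ring
  simp only [heatOp, h1 _ hp, h2, h3, Finset.sum_add_distrib, ← Finset.sum_mul, ← Finset.mul_sum]
  ring

lemma heatOp_sum_sq {κ : Type*} [Fintype κ] {A : κ → X → ℝ} (hΩ : IsOpen Ω)
    (hA : ∀ j, ContDiffOn ℝ ∞ (A j) Ω) (hp : p ∈ Ω) :
    heatOp τ e Φ (fun q => ∑ j, A j q * A j q) p
      = ∑ j, (2 * A j p * heatOp τ e Φ (A j) p - 2 * ∑ i, dirDeriv (e i) (A j) p ^ 2) := by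
  have hsum : heatOp τ e Φ (fun q => ∑ j, A j q * A j q) p
      = ∑ j, heatOp τ e Φ (fun q => A j q * A j q) p := by
    have hB (j : κ) : ContDiffOn ℝ ∞ (fun q => A j q * A j q) Ω := (hA j).mul (hA j)
    have h1 (v : X) : Set.EqOn (dirDeriv v fun q => ∑ j, A j q * A j q)
        (fun q => ∑ j, dirDeriv v (fun q => A j q * A j q) q) Ω := fun q hq =>
      dirDeriv_sum (fun j => (hB j).differentiableAt_of_isOpen hΩ hq) v
    have h2 (i : ι) := (dirDeriv_congr hΩ (h1 (e i)) (e i) hp).trans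
      (dirDeriv_sum (fun j => ((hB j).dirDeriv hΩ _).differentiableAt_of_isOpen hΩ hp) (e i))
    simp only [heatOp, h1 _ hp, h2, Finset.mul_sum, Finset.sum_sub_distrib]
    rw [Finset.sum_comm (γ := κ), Finset.sum_comm (γ := κ)]
  rw [hsum]
  refine Finset.sum_congr rfl fun j _ => ?_
  rw [heatOp_mul hΩ (hA j) (hA j) hp]
  simp only [sq]
  ring

lemma heatOp_dirDeriv (hΩ : IsOpen Ω) (hΦ : ContDiffOn ℝ ∞ Φ Ω) (hF : ContDiffOn ℝ ∞ F Ω)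
    (hp : p ∈ Ω) (v : X) :
    heatOp τ e Φ (dirDeriv v F) p = dirDeriv v (heatOp τ e Φ F) p
      - ∑ i, dirDeriv v (dirDeriv (e i) Φ) p * dirDeriv (e i) F p := by
  have dA {A : X → ℝ} (hA : ContDiffOn ℝ ∞ A Ω) := hA.differentiableAt_of_isOpen hΩ hp
  have hFi (i : ι) := hF.dirDeriv hΩ (e i)
  have hΦi (i : ι) := hΦ.dirDeriv hΩ (e i)
  have hFii (i : ι) := (hFi i).dirDeriv hΩ (e i)
  have hτ := hF.dirDeriv hΩ τ
  have key : dirDeriv v (heatOp τ e Φ F) p = dirDeriv v (dirDeriv τ F) p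
      - (∑ i, dirDeriv v (dirDeriv (e i) (dirDeriv (e i) F)) p
      - ∑ i, (dirDeriv v (dirDeriv (e i) Φ) p * dirDeriv (e i) F p
        + dirDeriv (e i) Φ p * dirDeriv v (dirDeriv (e i) F) p)) := by
    have s1 : DifferentiableAt ℝ (fun q => ∑ i, dirDeriv (e i) (dirDeriv (e i) F) q) p :=
      DifferentiableAt.fun_sum fun i _ => dA (hFii i)
    have s2 : DifferentiableAt ℝ (fun q => ∑ i, dirDeriv (e i) Φ q * dirDeriv (e i) F q) p :=
      DifferentiableAt.fun_sum fun i _ => (dA (hΦi i)).fun_mul (dA (hFi i))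
    unfold heatOp
    rw [dirDeriv_sub (dA hτ) (s1.fun_sub s2), dirDeriv_sub s1 s2, dirDeriv_sum fun i => dA (hFii i),
      dirDeriv_sum fun i => (dA (hΦi i)).fun_mul (dA (hFi i))]
    simp only [fun i => dirDeriv_mul (dA (hΦi i)) (dA (hFi i)) v]
  have c1 (i : ι) : dirDeriv v (dirDeriv (e i) F) p = dirDeriv (e i) (dirDeriv v F) p :=
    dirDeriv_comm hΩ hF hp v (e i)
  have c2 (i : ι) : dirDeriv v (dirDeriv (e i) (dirDeriv (e i) F)) p
      = dirDeriv (e i) (dirDeriv (e i) (dirDeriv v F)) p :=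
    (dirDeriv_comm hΩ (hFi i) hp v (e i)).trans
      (dirDeriv_congr hΩ (fun q hq => dirDeriv_comm hΩ hF hq v (e i)) (e i) hp)
  rw [key, dirDeriv_comm hΩ hF hp v τ]
  simp only [c1, c2, heatOp, Finset.sum_add_distrib]
  ring

/-- Bochner formula for `|∇F|²/F` along a positive solution `F` of the heat equation. -/
lemma heatOp_sum_sq_div (hΩ : IsOpen Ω) (hΦ : ContDiffOn ℝ ∞ Φ Ω) (hF : ContDiffOn ℝ ∞ F Ω)
    (hpos : ∀ q ∈ Ω, 0 < F q) (hheat : ∀ q ∈ Ω, heatOp τ e Φ F q = 0) (hp : p ∈ Ω) :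
    heatOp τ e Φ (fun q => (∑ j, dirDeriv (e j) F q * dirDeriv (e j) F q) / F q) p
      = -(2 / F p) * (∑ i, ∑ j, (dirDeriv (e i) (dirDeriv (e j) F) p
            - dirDeriv (e i) F p * dirDeriv (e j) F p / F p) ^ 2
          + ∑ j, ∑ i, dirDeriv (e j) F p * dirDeriv (e i) F p
            * dirDeriv (e j) (dirDeriv (e i) Φ) p) := by
  have hFj (j : ι) := hF.dirDeriv hΩ (e j)
  set W : X → ℝ := fun q => ∑ j, dirDeriv (e j) F q * dirDeriv (e j) F q with hWdef
  have hW : ContDiffOn ℝ ∞ W Ω := ContDiffOn.sum fun j _ => (hFj j).mul (hFj j)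
  set Q : X → ℝ := fun q => W q / F q with hQdef
  have hQ : ContDiffOn ℝ ∞ Q Ω := hW.div hF fun q hq => (hpos q hq).ne'
  have hWQ : Set.EqOn W (fun q => Q q * F q) Ω := fun q hq => by
    simp only [hQdef]
    field_simp [(hpos q hq).ne']
  have dF := hF.differentiableAt_of_isOpen hΩ hp
  have dFj (j : ι) := (hFj j).differentiableAt_of_isOpen hΩ hp
  have hFp := (hpos p hp).ne'
  have hWi (i : ι) : dirDeriv (e i) W p
      = 2 * ∑ j, dirDeriv (e j) F p * dirDeriv (e i) (dirDeriv (e j) F) p := by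
    rw [hWdef, dirDeriv_sum fun j => (dFj j).fun_mul (dFj j), Finset.mul_sum]
    refine Finset.sum_congr rfl fun j _ => ?_
    rw [dirDeriv_mul (dFj j) (dFj j)]
    ring
  have hQi (i : ι) : dirDeriv (e i) Q p = (dirDeriv (e i) W p - Q p * dirDeriv (e i) F p) / F p := by
    rw [dirDeriv_congr hΩ hWQ (e i) hp, dirDeriv_mul (hQ.differentiableAt_of_isOpen hΩ hp) dF]
    field_simp
    ring
  have hdiv (v : X) : dirDeriv v (heatOp τ e Φ F) p = 0 := by
    rw [dirDeriv_congr hΩ (G := fun _ => 0) hheat v hp]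
    simp [dirDeriv]
  have hHW : heatOp τ e Φ W p = -2 * (∑ i, ∑ j, dirDeriv (e i) (dirDeriv (e j) F) p ^ 2)
      - 2 * ∑ j, ∑ i, dirDeriv (e j) F p * dirDeriv (e i) F p
            * dirDeriv (e j) (dirDeriv (e i) Φ) p := by
    rw [hWdef, heatOp_sum_sq hΩ hFj hp, Finset.sum_comm]
    simp only [fun j => heatOp_dirDeriv (τ := τ) (e := e) hΩ hΦ hF hp (e j), hdiv, zero_sub,
      Finset.mul_sum, ← Finset.sum_sub_distrib]
    simp only [mul_neg, ← Finset.sum_neg_distrib, Finset.mul_sum, ← Finset.sum_sub_distrib]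
    refine Finset.sum_congr rfl fun j _ => Finset.sum_congr rfl fun i _ => ?_
    ring
  have hHQ : heatOp τ e Φ W p
      = heatOp τ e Φ Q p * F p - 2 * ∑ i, dirDeriv (e i) Q p * dirDeriv (e i) F p := by
    rw [heatOp_congr hΩ hWQ hp, heatOp_mul hΩ hQ hF hp, hheat p hp]
    ring
  have hcross : ∑ i, dirDeriv (e i) Q p * dirDeriv (e i) F p
      = 2 / F p * (∑ i, ∑ j, dirDeriv (e i) F p * dirDeriv (e j) F p
          * dirDeriv (e i) (dirDeriv (e j) F) p) - W p ^ 2 / F p ^ 2 := by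
    have h1 (i : ι) : dirDeriv (e i) Q p * dirDeriv (e i) F p
        = 2 / F p * (∑ j, dirDeriv (e i) F p * dirDeriv (e j) F p
          * dirDeriv (e i) (dirDeriv (e j) F) p)
          - W p / F p ^ 2 * (dirDeriv (e i) F p * dirDeriv (e i) F p) := by
      have : ∑ j, dirDeriv (e i) F p * dirDeriv (e j) F p * dirDeriv (e i) (dirDeriv (e j) F) p
          = dirDeriv (e i) F p
            * ∑ j, dirDeriv (e j) F p * dirDeriv (e i) (dirDeriv (e j) F) p := by
        rw [Finset.mul_sum]
        exact Finset.sum_congr rfl fun j _ => by ring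
      rw [hQi, hWi, this, hQdef]
      field_simp
    simp only [h1, Finset.sum_sub_distrib, ← Finset.mul_sum]
    rw [← show W p = ∑ i, dirDeriv (e i) F p * dirDeriv (e i) F p from rfl]
    ring
  have hsq : ∑ i, ∑ j, (dirDeriv (e i) (dirDeriv (e j) F) p
        - dirDeriv (e i) F p * dirDeriv (e j) F p / F p) ^ 2
      = ∑ i, ∑ j, dirDeriv (e i) (dirDeriv (e j) F) p ^ 2
        - 2 / F p * (∑ i, ∑ j, dirDeriv (e i) F p * dirDeriv (e j) F p
          * dirDeriv (e i) (dirDeriv (e j) F) p) + W p ^ 2 / F p ^ 2 := by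
    have hW2 : W p ^ 2 / F p ^ 2
        = ∑ i, ∑ j, (dirDeriv (e i) F p * dirDeriv (e j) F p / F p) ^ 2 := by
      rw [sq, show W p = ∑ i, dirDeriv (e i) F p * dirDeriv (e i) F p from rfl,
        Finset.sum_mul_sum, Finset.sum_div]
      refine Finset.sum_congr rfl fun i _ => ?_
      rw [Finset.sum_div]
      refine Finset.sum_congr rfl fun j _ => ?_
      ring
    simp only [hW2, Finset.mul_sum, ← Finset.sum_sub_distrib, ← Finset.sum_add_distrib]
    refine Finset.sum_congr rfl fun i _ => Finset.sum_congr rfl fun j _ => ?_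
    ring
  rw [hsq]
  have := hHQ.symm.trans hHW
  rw [hcross] at this
  field_simp at this ⊢
  linarith

end HeatOperator

/-- The refined trace inequality behind the curvature-dimension condition. -/
lemma sq_trace_sub_le {n : ℕ} (hn : 1 ≤ n) {m : ℝ} (hm : (n : ℝ) < m)
    (A : Fin n → Fin n → ℝ) (b : ℝ) :
    (∑ i, A i i - b) ^ 2 / m ≤ ∑ i, ∑ j, A i j ^ 2 + b ^ 2 / (m - n) := by
  have hn' : (0 : ℝ) < n := by exact_mod_cast hn
  have hmn : 0 < m - n := sub_pos.2 hm
  have hm0 : 0 < m := hn'.trans hm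
  set a := ∑ i, A i i
  have h1 : a ^ 2 ≤ n * ∑ i, ∑ j, A i j ^ 2 := by
    calc a ^ 2 ≤ n * ∑ i, A i i ^ 2 := by
          simpa using sq_sum_le_card_mul_sum_sq (s := Finset.univ) (f := fun i => A i i)
      _ ≤ _ := by
          gcongr with i
          exact Finset.single_le_sum (f := fun j => A i j ^ 2) (fun j _ => sq_nonneg _)
            (Finset.mem_univ i)
  have h2 : a ^ 2 / n ≤ ∑ i, ∑ j, A i j ^ 2 := by
    rw [div_le_iff₀ hn']
    linarith
  have h3 : (a - b) ^ 2 / m ≤ a ^ 2 / n + b ^ 2 / (m - n) := by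
    have : a ^ 2 / n + b ^ 2 / (m - n) - (a - b) ^ 2 / m
        = ((m - n) * a + n * b) ^ 2 / (n * (m - n) * m) := by
      field_simp
      ring
    have : 0 ≤ ((m - n) * a + n * b) ^ 2 / (n * (m - n) * m) := by positivity
    linarith
  linarith

section SpaceTime

variable {n : ℕ}

local notation "E" => EuclideanSpace ℝ (Fin n)

/-- The spatial coordinate directions of `ℝ × ℝⁿ`. -/
def spaceDir (n : ℕ) (i : Fin n) : ℝ × EuclideanSpace ℝ (Fin n) := (0, EuclideanSpace.single i 1)

lemma inner_gradient_eq {f : E → ℝ} (x v : E) : ⟪gradient f x, v⟫ = fderiv ℝ f x v := by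
  simp [gradient]

lemma gradient_apply_eq {f : E → ℝ} (x : E) (i : Fin n) :
    gradient f x i = fderiv ℝ f x (EuclideanSpace.single i 1) := by
  rw [← inner_gradient_eq, EuclideanSpace.inner_single_right]
  simp

lemma inner_gradient_gradient {f g : E → ℝ} (x : E) :
    ⟪gradient f x, gradient g x⟫ = ∑ i, fderiv ℝ f x (EuclideanSpace.single i 1)
      * fderiv ℝ g x (EuclideanSpace.single i 1) := by
  simp only [PiLp.inner_apply, gradient_apply_eq]
  exact Finset.sum_congr rfl fun i _ => by simp [mul_comm]

lemma deriv_slice {F : ℝ × E → ℝ} {t : ℝ} {x : E} (hF : DifferentiableAt ℝ F (t, x)) :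
    deriv (fun s => F (s, x)) t = dirDeriv (1, 0) F (t, x) :=
  (hF.hasFDerivAt.comp_hasDerivAt t ((hasDerivAt_id t).prodMk (hasDerivAt_const t x))).deriv

lemma fderiv_slice {F : ℝ × E → ℝ} {t : ℝ} {x : E} (hF : DifferentiableAt ℝ F (t, x)) (v : E) :
    fderiv ℝ (fun y => F (t, y)) x v = dirDeriv (0, v) F (t, x) := by
  have := hF.hasFDerivAt.comp x ((hasFDerivAt_const t x).prodMk (hasFDerivAt_id x))
  rw [show (fun y => F (t, y)) = F ∘ Prod.mk t from rfl, this.fderiv]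
  simp [dirDeriv]

/-- The space-time domain `t > 0`. -/
def posTime (n : ℕ) : Set (ℝ × EuclideanSpace ℝ (Fin n)) := {p | 0 < p.1}

lemma isOpen_posTime : IsOpen (posTime n) := isOpen_lt continuous_const continuous_fst

lemma hess_slice {F : ℝ × E → ℝ} (hF : ContDiffOn ℝ ∞ F (posTime n)) {t : ℝ} (ht : 0 < t)
    (x v w : E) :
    hess n (fun y => F (t, y)) x v w = dirDeriv (0, w) (dirDeriv (0, v) F) (t, x) := by
  have hmem (y : E) : (t, y) ∈ posTime n := ht
  have h1 (y : E) := fderiv_slice (hF.differentiableAt_of_isOpen isOpen_posTime (hmem y)) v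
  simp only [hess, h1]
  exact fderiv_slice ((hF.dirDeriv isOpen_posTime _).differentiableAt_of_isOpen isOpen_posTime
    (hmem x)) w

lemma deriv_sub_witten_slice {φ : E → ℝ} (hφ : ContDiff ℝ ∞ φ) {F : ℝ × E → ℝ}
    (hF : ContDiffOn ℝ ∞ F (posTime n)) {t : ℝ} (ht : 0 < t) (x : E) :
    deriv (fun s => F (s, x)) t - witten n φ (fun y => F (t, y)) x
      = heatOp (1, 0) (spaceDir n) (fun p => φ p.2) F (t, x) := by
  have hd := hF.differentiableAt_of_isOpen isOpen_posTime (show (t, x) ∈ posTime n from ht)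
  have hΦ : DifferentiableAt ℝ (fun p : ℝ × E => φ p.2) (t, x) :=
    (hφ.comp contDiff_snd).differentiable (by simp) _
  have h1 (v : E) : fderiv ℝ φ x v = dirDeriv (0, v) (fun p : ℝ × E => φ p.2) (t, x) :=
    fderiv_slice hΦ v
  simp only [witten, lap, heatOp, inner_gradient_gradient, deriv_slice hd, hess_slice hF ht,
    fderiv_slice hd, h1, spaceDir]

lemma hess_gradient_eq_sum {φ f : E → ℝ} (hφ : ContDiff ℝ ∞ φ) (x : E) :
    hess n φ x (gradient f x) (gradient f x)
      = ∑ j, ∑ i, fderiv ℝ f x (EuclideanSpace.single j 1)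
        * fderiv ℝ f x (EuclideanSpace.single i 1)
        * hess n φ x (EuclideanSpace.single i 1) (EuclideanSpace.single j 1) := by
  have hh (v w : E) : hess n φ x v w = fderiv ℝ (fderiv ℝ φ) x w v :=
    dirDeriv_dirDeriv_eq_fderiv isOpen_univ hφ.contDiffOn (Set.mem_univ x) w v
  have hg : gradient f x = ∑ i, fderiv ℝ f x (EuclideanSpace.single i 1)
      • EuclideanSpace.single i (1 : ℝ) := by
    conv_lhs => rw [← (EuclideanSpace.basisFun (Fin n) ℝ).sum_repr (gradient f x)]
    simp [gradient_apply_eq]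
  simp only [hh]
  rw [hg]
  simp only [map_sum, map_smul, sum_apply, smul_apply,
    smul_eq_mul, Finset.mul_sum, mul_assoc]
  rw [Finset.sum_comm]
  refine Finset.sum_congr rfl fun j _ => Finset.sum_congr rfl fun i _ => ?_
  ring

lemma heatOp_time_mul {Φ F : ℝ × E → ℝ} {c : ℝ → ℝ} {c' t : ℝ}
    (hc : ContDiffOn ℝ ∞ (fun p : ℝ × E => c p.1) (posTime n))
    (hF : ContDiffOn ℝ ∞ F (posTime n)) (ht : 0 < t) (hc' : HasDerivAt c c' t) (x : E) :
    heatOp (1, 0) (spaceDir n) Φ (fun p => c p.1 * F p) (t, x)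
      = c' * F (t, x) + c t * heatOp (1, 0) (spaceDir n) Φ F (t, x) := by
  have hp : (t, x) ∈ posTime n := ht
  have h0 (i : Fin n) : Set.EqOn (dirDeriv (spaceDir n i) fun p : ℝ × E => c p.1)
      (fun _ => 0) (posTime n) := fun q hq => by
    have := fderiv_slice (hc.differentiableAt_of_isOpen isOpen_posTime hq)
      (EuclideanSpace.single i 1)
    simpa [spaceDir] using this.symm
  have h00 (i : Fin n) : dirDeriv (spaceDir n i) (dirDeriv (spaceDir n i)
      fun p : ℝ × E => c p.1) (t, x) = 0 := by
    rw [dirDeriv_congr isOpen_posTime (h0 i) _ hp]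
    simp [dirDeriv]
  have hτ : dirDeriv (1, 0) (fun p : ℝ × E => c p.1) (t, x) = c' := by
    rw [← deriv_slice (hc.differentiableAt_of_isOpen isOpen_posTime hp)]
    exact hc'.deriv
  rw [heatOp_mul isOpen_posTime hc hF hp]
  simp only [fun i => h0 i hp]
  rw [heatOp]
  simp [fun i => h0 i hp, h00, hτ]

end SpaceTime

/-- Evolution inequality (3.1) for `h = ∂ₜu − e^{−2Kt}|∇u|²/u + e^{2Kt}(m/(2t))u` along the
heat equation of the Witten Laplacian on `ℝⁿ` under the `CD(−K, m)` condition: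
`(∂ₜ − L)h ≥ (2/(mu))e^{−2Kt}(∂ₜu − |∇u|²/u)² − e^{2Kt}(m/(2t²))u`. -/
theorem evolution_inequality_h
    (n : ℕ) (hn : 1 ≤ n) (m K : ℝ) (hm : (n : ℝ) < m) (hK : 0 ≤ K)
    (φ : EuclideanSpace ℝ (Fin n) → ℝ) (hφ : ContDiff ℝ (⊤ : ℕ∞) φ)
    (hCD : CDcond n φ m K)
    (u : ℝ → EuclideanSpace ℝ (Fin n) → ℝ)
    (hu : ContDiffOn ℝ (⊤ : ℕ∞) (fun p : ℝ × EuclideanSpace ℝ (Fin n) => u p.1 p.2)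
      {p : ℝ × EuclideanSpace ℝ (Fin n) | 0 < p.1})
    (hpos : ∀ t > (0 : ℝ), ∀ x, 0 < u t x)
    (hheat : ∀ t > (0 : ℝ), ∀ x, deriv (fun s => u s x) t = witten n φ (u t) x)
    (h : ℝ → EuclideanSpace ℝ (Fin n) → ℝ)
    (hh : h = fun t x =>
      deriv (fun s => u s x) t
        - Real.exp (-2 * K * t) * ‖gradient (u t) x‖ ^ 2 / u t x
        + Real.exp (2 * K * t) * (m / (2 * t)) * u t x) :
    ∀ t > (0 : ℝ), ∀ x,
      deriv (fun s => h s x) t - witten n φ (h t) x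
        ≥ (2 / (m * u t x)) * Real.exp (-2 * K * t) *
            (deriv (fun s => u s x) t - ‖gradient (u t) x‖ ^ 2 / u t x) ^ 2
          - Real.exp (2 * K * t) * (m / (2 * t ^ 2)) * u t x := by
  intro t ht x
  set U : ℝ × EuclideanSpace ℝ (Fin n) → ℝ := fun p => u p.1 p.2 with hUdef
  set Φ : ℝ × EuclideanSpace ℝ (Fin n) → ℝ := fun p => φ p.2 with hΦdef
  have hΩ : IsOpen (posTime n) := isOpen_posTime
  have hU : ContDiffOn ℝ ∞ U (posTime n) := hu
  have hΦ : ContDiffOn ℝ ∞ Φ (posTime n) := (hφ.comp contDiff_snd).contDiffOn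
  have hUpos : ∀ q ∈ posTime n, 0 < U q := fun q hq => hpos q.1 hq q.2
  have hUheat : ∀ q ∈ posTime n, heatOp (1, 0) (spaceDir n) Φ U q = 0 := fun q hq => by
    rw [← deriv_sub_witten_slice hφ hU hq q.2]
    exact sub_eq_zero.2 (hheat q.1 hq q.2)
  set P : Fin n → ℝ × EuclideanSpace ℝ (Fin n) → ℝ := fun j => dirDeriv (spaceDir n j) U with hPdef
  have hP (j : Fin n) : ContDiffOn ℝ ∞ (P j) (posTime n) := hU.dirDeriv hΩ _
  have hgrad (q : ℝ × EuclideanSpace ℝ (Fin n)) (hq : q ∈ posTime n) (j : Fin n) :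
      fderiv ℝ (u q.1) q.2 (EuclideanSpace.single j 1) = P j q :=
    fderiv_slice (hU.differentiableAt_of_isOpen hΩ hq) _
  have hnorm (q : ℝ × EuclideanSpace ℝ (Fin n)) (hq : q ∈ posTime n) :
      ‖gradient (u q.1) q.2‖ ^ 2 = ∑ j, P j q * P j q := by
    rw [← real_inner_self_eq_norm_sq, inner_gradient_gradient]
    simp only [hgrad q hq]
  have hdt (q : ℝ × EuclideanSpace ℝ (Fin n)) (hq : q ∈ posTime n) :
      deriv (fun s => u s q.2) q.1 = dirDeriv (1, 0) U q :=
    deriv_slice (hU.differentiableAt_of_isOpen hΩ hq)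
  set T : ℝ × EuclideanSpace ℝ (Fin n) → ℝ := dirDeriv (1, 0) U with hTdef
  have hT : ContDiffOn ℝ ∞ T (posTime n) := hU.dirDeriv hΩ _
  set Q : ℝ × EuclideanSpace ℝ (Fin n) → ℝ := fun q => (∑ j, P j q * P j q) / U q with hQdef
  have hQ : ContDiffOn ℝ ∞ Q (posTime n) :=
    (ContDiffOn.sum fun j _ => (hP j).mul (hP j)).div hU fun q hq => (hUpos q hq).ne'
  set c₁ : ℝ → ℝ := fun s => -Real.exp (-2 * K * s)
  set c₂ : ℝ → ℝ := fun s => Real.exp (2 * K * s) * (m / (2 * s))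
  have hc₁ : ContDiffOn ℝ ∞ (fun p : ℝ × EuclideanSpace ℝ (Fin n) => c₁ p.1) (posTime n) := by fun_prop
  have hc₂ : ContDiffOn ℝ ∞ (fun p : ℝ × EuclideanSpace ℝ (Fin n) => c₂ p.1) (posTime n) := by
    refine ContDiffOn.mul (by fun_prop) (ContDiffOn.div (by fun_prop) (by fun_prop) ?_)
    intro q hq
    exact mul_ne_zero two_ne_zero (ne_of_gt hq)
  have hc₁' : HasDerivAt c₁ (2 * K * Real.exp (-2 * K * t)) t := by
    refine HasDerivAt.congr_deriv (((hasDerivAt_id t).const_mul (-2 * K)).exp).neg ?_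
    simp only [id]
    ring
  have hc₂' : HasDerivAt c₂ (Real.exp (2 * K * t) * (K * m / t - m / (2 * t ^ 2))) t := by
    have h1 := ((hasDerivAt_id t).const_mul (2 * K)).exp
    have h2 := (hasDerivAt_const t m).div ((hasDerivAt_id t).const_mul 2)
      (mul_ne_zero two_ne_zero ht.ne')
    refine HasDerivAt.congr_deriv (h1.mul h2) ?_
    simp only [id]
    field_simp
    ring
  have hp : (t, x) ∈ posTime n := ht
  have hS₁ : ContDiffOn ℝ ∞ (fun q : ℝ × EuclideanSpace ℝ (Fin n) => c₁ q.1 * Q q) (posTime n) := hc₁.mul hQ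
  have hS₂ : ContDiffOn ℝ ∞ (fun q : ℝ × EuclideanSpace ℝ (Fin n) => c₂ q.1 * U q) (posTime n) := hc₂.mul hU
  have hheq : Set.EqOn (fun q : ℝ × EuclideanSpace ℝ (Fin n) => h q.1 q.2) (fun q => T q + c₁ q.1 * Q q + c₂ q.1 * U q)
      (posTime n) := fun q hq => by
    simp only [hh, hdt q hq, hnorm q hq]
    simp only [hQdef, c₁, c₂, hUdef]
    ring
  have hhsmooth : ContDiffOn ℝ ∞ (fun q : ℝ × EuclideanSpace ℝ (Fin n) => h q.1 q.2) (posTime n) :=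
    ((hT.add hS₁).add hS₂).congr hheq
  have hHT : heatOp (1, 0) (spaceDir n) Φ T (t, x) = 0 := by
    rw [hTdef, heatOp_dirDeriv hΩ hΦ hU hp,
      dirDeriv_congr hΩ (G := fun _ => 0) hUheat _ hp]
    have h0 (i : Fin n) : dirDeriv (1, 0) (dirDeriv (spaceDir n i) Φ) (t, x) = 0 := by
      have hτ : Set.EqOn (dirDeriv (1, 0) Φ) (fun _ => 0) (posTime n) := fun q hq => by
        have := deriv_slice (hΦ.differentiableAt_of_isOpen hΩ (p := (q.1, q.2)) hq)
        simpa [hΦdef] using this.symm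
      rw [dirDeriv_comm hΩ hΦ hp, dirDeriv_congr hΩ hτ _ hp]
      simp [dirDeriv]
    simp [h0]
    simp [dirDeriv]
  have hevol : deriv (fun s => h s x) t - witten n φ (h t) x
      = 2 * K * Real.exp (-2 * K * t) * Q (t, x)
        - Real.exp (-2 * K * t) * heatOp (1, 0) (spaceDir n) Φ Q (t, x)
        + Real.exp (2 * K * t) * (K * m / t - m / (2 * t ^ 2)) * u t x := by
    refine (deriv_sub_witten_slice hφ hhsmooth ht x).trans ?_
    rw [heatOp_congr hΩ hheq hp, heatOp_add hΩ (hT.add hS₁) hS₂ hp, heatOp_add hΩ hT hS₁ hp, hHT,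
      heatOp_time_mul hc₁ hQ ht hc₁', heatOp_time_mul hc₂ hU ht hc₂', hUheat _ hp]
    simp only [c₁, hUdef]
    ring
  have hgx := hgrad (t, x) hp
  have hnx := hnorm (t, x) hp
  have hdx := hdt (t, x) hp
  simp only at hgx hnx hdx
  have hux := hpos t ht x
  have hUx : U (t, x) = u t x := rfl
  have hHQ := heatOp_sum_sq_div hΩ hΦ hU hUpos hUheat hp
  have hcd := hCD x (gradient (u t) x)
  rw [hess_gradient_eq_sum hφ, inner_gradient_eq] at hcd
  set b := fderiv ℝ φ x (gradient (u t) x)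
  have htrace := sq_trace_sub_le hn hm (fun i j => dirDeriv (spaceDir n i) (P j) (t, x)
    - P i (t, x) * P j (t, x) / u t x) b
  have hTx : T (t, x) - Q (t, x) = ∑ i, (dirDeriv (spaceDir n i) (P i) (t, x)
    - P i (t, x) * P i (t, x) / u t x) - b := by
    have h1 : T (t, x) = lap n (u t) x - b := by
      rw [← hdx, hheat t ht x, witten, inner_gradient_eq]
    have h2 : lap n (u t) x = ∑ i, dirDeriv (spaceDir n i) (P i) (t, x) :=
      Finset.sum_congr rfl fun i _ => hess_slice hU ht x _ _
    rw [h1, h2, Finset.sum_sub_distrib, ← Finset.sum_div]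
    simp only [hQdef, hUx]
    ring
  have hhess : ∑ j, ∑ i, P j (t, x) * P i (t, x)
        * dirDeriv (spaceDir n j) (dirDeriv (spaceDir n i) Φ) (t, x)
      ≥ b ^ 2 / (m - n) - K * ∑ j, P j (t, x) * P j (t, x) := by
    have h1 (i j : Fin n) : hess n φ x (EuclideanSpace.single i 1) (EuclideanSpace.single j 1)
        = dirDeriv (spaceDir n j) (dirDeriv (spaceDir n i) Φ) (t, x) :=
      hess_slice hΦ ht x _ _
    simp only [hgx, h1, hnx] at hcd
    linarith
  have hQx : Q (t, x) = (∑ j, P j (t, x) * P j (t, x)) / u t x := rfl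
  set W := ∑ j, P j (t, x) * P j (t, x)
  have hm0 : 0 < m := (Nat.cast_nonneg n).trans_lt hm
  have hbound : -heatOp (1, 0) (spaceDir n) Φ Q (t, x)
      ≥ 2 / u t x * ((T (t, x) - Q (t, x)) ^ 2 / m - K * W) := by
    rw [hQdef, hHQ, neg_mul, neg_neg, ← hQdef, hTx]
    exact mul_le_mul_of_nonneg_left (by linarith) (by positivity)
  rw [hevol, hdx, hnx, ← hQx]
  have hexp := mul_le_mul_of_nonneg_left hbound (Real.exp_pos (-2 * K * t)).le
  have hlast : 0 ≤ Real.exp (2 * K * t) * (K * m / t) * u t x := by positivity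
  have heq : Real.exp (-2 * K * t) * (2 / u t x * ((T (t, x) - Q (t, x)) ^ 2 / m - K * W))
      = 2 / (m * u t x) * Real.exp (-2 * K * t) * (T (t, x) - Q (t, x)) ^ 2
        - 2 * K * Real.exp (-2 * K * t) * Q (t, x) := by
    rw [hQx]
    field_simp
  rw [heq] at hexp
  linarith
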